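/- arXiv:2402.13269 — 2 statements merged into one kernel-verified Lean document; each statement's English description precedes it below -/
import Mathlib

section
/- Assume (F1). Then there exist C², 1-periodic functions p₁ ≤ p₂ on ℝ with κ₀ ≤ pᵢ(x) ≤ κ⁰ and (pᵢ^m)″(x) + f(x,pᵢ(x))(κ(x) − pᵢ(x)) = 0 for all x ∈ ℝ (i = 1,2), which are respectively the minimal and maximal stationary solutions in the range [κ₀,κ⁰]: every C² function p on ℝ with κ₀ ≤ p(x) ≤ κ⁰ and (p^m)″(x) + f(x,p(x))(κ(x) − p(x)) = 0 for all x satisfies p₁(x) ≤ p(x) ≤ p₂(x) for all x ∈ ℝ. -/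
open MeasureTheory Set Filter

noncomputable section

/-- Condition (F1): `f` and `κ` are `C²`, 1-periodic in `x`, `f(x,0)=0`, and there is `θ > 0`
with `f(x,u) > 0` for `u > θ` and `κ(x) > θ`. -/
def CondF1 (f : ℝ → ℝ → ℝ) (κ : ℝ → ℝ) (θ : ℝ) : Prop :=
  ContDiff ℝ 2 (Function.uncurry f) ∧ ContDiff ℝ 2 κ ∧
  (∀ x u, f (x + 1) u = f x u) ∧ (∀ x, κ (x + 1) = κ x) ∧
  (∀ x, f x 0 = 0) ∧ 0 < θ ∧ (∀ x u, θ < u → 0 < f x u) ∧ (∀ x, θ < κ x)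

/-- `κ₀ := min κ` (over a period). -/
def kappaMin (κ : ℝ → ℝ) : ℝ := sInf (κ '' Icc 0 1)

/-- `κ⁰ := max κ` (over a period). -/
def kappaMax (κ : ℝ → ℝ) : ℝ := sSup (κ '' Icc 0 1)

/-- Condition (F2): existence of a compactly supported traveling subsolution profile `φ₀`
with speed `c₀`. -/
def CondF2 (m : ℝ) (f : ℝ → ℝ → ℝ) (κ : ℝ → ℝ) (c₀ l₀ : ℝ) (φ₀ : ℝ → ℝ) : Prop :=
  0 < c₀ ∧ 0 < l₀ ∧ ContDiffOn ℝ 2 φ₀ (Icc (-l₀) l₀) ∧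
  φ₀ (-l₀) = 0 ∧ φ₀ l₀ = 0 ∧ (∀ z ∈ Ioo (-l₀) l₀, 0 < φ₀ z) ∧
  c₀ < -(derivWithin φ₀ (Icc (-l₀) l₀) l₀) ∧
  ∀ (x : ℝ), ∀ z ∈ Icc (-l₀) l₀,
    0 ≤ derivWithin (derivWithin (fun w => φ₀ w ^ m) (Icc (-l₀) l₀)) (Icc (-l₀) l₀) z
        + c₀ * derivWithin φ₀ (Icc (-l₀) l₀) z
        + f x (φ₀ z) * (κ x - φ₀ z)

/-- A (bounded, continuous) very weak solution of `u_t = (u^m)_{xx} + f(x,u)(κ(x)-u)`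
on `ℝ × (0,τ)` with initial data `u₀`. -/
def VeryWeakSol (m : ℝ) (f : ℝ → ℝ → ℝ) (κ : ℝ → ℝ) (τ : ℝ)
    (u₀ : ℝ → ℝ) (u : ℝ → ℝ → ℝ) : Prop :=
  ContinuousOn (fun q : ℝ × ℝ => u q.1 q.2) (univ ×ˢ Ioc (0:ℝ) τ) ∧
  (∃ M : ℝ, ∀ x : ℝ, ∀ t ∈ Ioc (0:ℝ) τ, |u x t| ≤ M) ∧
  ∀ φ : ℝ → ℝ → ℝ, ContDiff ℝ (⊤ : ℕ∞) (Function.uncurry φ) →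
    HasCompactSupport (Function.uncurry φ) →
    ∫ x : ℝ, u x τ * φ x τ =
      (∫ x : ℝ, u₀ x * φ x 0)
      + (∫ t in Ioo (0:ℝ) τ, ∫ x : ℝ, f x (u x t) * (κ x - u x t) * φ x t)
      + (∫ t in Ioo (0:ℝ) τ, ∫ x : ℝ,
          (u x t * deriv (fun s => φ x s) t + u x t ^ m * deriv (deriv (fun y => φ y t)) x))

/-- A global very weak solution: a very weak solution on `ℝ × (0,τ)` for every `τ > 0`. -/
def GlobalVeryWeakSol (m : ℝ) (f : ℝ → ℝ → ℝ) (κ : ℝ → ℝ)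
    (u₀ : ℝ → ℝ) (u : ℝ → ℝ → ℝ) : Prop :=
  ∀ τ > (0:ℝ), VeryWeakSol m f κ τ u₀ u

/-- `e^{-kx} ∫_{-∞}^x e^{ky} h(y) dy`, the bounded solution of `L' + k L = h`. -/
def leftResolvent (k : ℝ) (h : ℝ → ℝ) (x : ℝ) : ℝ :=
  Real.exp (-(k * x)) * ∫ y in Iic x, Real.exp (k * y) * h y

/-- The bounded solution of `-R'' + k² R = h` on the line. -/
def lineResolvent (k : ℝ) (h : ℝ → ℝ) (x : ℝ) : ℝ :=
  (leftResolvent k h x + leftResolvent k (fun y => h (-y)) (-x)) / (2 * k)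

section Resolvent

variable {k M : ℝ} {h : ℝ → ℝ}

lemma integrableOn_exp_mul_bounded (hk : 0 < k) (hm : Measurable h) (hb : ∀ x, |h x| ≤ M)
    (x : ℝ) : IntegrableOn (fun y => Real.exp (k * y) * h y) (Iic x) :=
  Integrable.mul_bdd (integrableOn_exp_mul_Iic hk x) hm.aestronglyMeasurable
    (Eventually.of_forall hb)

lemma leftResolvent_mono {g : ℝ → ℝ} (hk : 0 < k) (hm : Measurable h) (hb : ∀ x, |h x| ≤ M)
    (gm : Measurable g) (gb : ∀ x, |g x| ≤ M) (hg : ∀ x, h x ≤ g x) (x : ℝ) :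
    leftResolvent k h x ≤ leftResolvent k g x :=
  mul_le_mul_of_nonneg_left
    (setIntegral_mono (integrableOn_exp_mul_bounded hk hm hb x)
      (integrableOn_exp_mul_bounded hk gm gb x)
      fun y => mul_le_mul_of_nonneg_left (hg y) (Real.exp_pos _).le)
    (Real.exp_pos _).le

lemma leftResolvent_const (hk : 0 < k) (c x : ℝ) :
    leftResolvent k (fun _ => c) x = c / k := by
  have : Real.exp (-(k * x)) * Real.exp (k * x) = 1 := by
    rw [← Real.exp_add]; simp
  rw [leftResolvent, integral_mul_const, integral_exp_mul_Iic hk]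
  linear_combination (c / k) * this

lemma setIntegral_Iic_eq_add {q : ℝ → ℝ} (hq : ∀ x, IntegrableOn q (Iic x)) (x : ℝ) :
    ∫ y in Iic x, q y = (∫ y in Iic 0, q y) + ∫ y in (0)..x, q y := by
  rw [← intervalIntegral.integral_Iic_sub_Iic (hq 0) (hq x)]; ring

lemma continuous_leftResolvent (hk : 0 < k) (hm : Measurable h) (hb : ∀ x, |h x| ≤ M) :
    Continuous (leftResolvent k h) := by
  have hq := integrableOn_exp_mul_bounded hk hm hb
  have heq : leftResolvent k h = fun x => Real.exp (-(k * x)) *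
      ((∫ y in Iic 0, Real.exp (k * y) * h y) + ∫ y in (0)..x, Real.exp (k * y) * h y) :=
    funext fun x => by rw [leftResolvent, setIntegral_Iic_eq_add hq]
  rw [heq]
  have : Continuous fun x => ∫ y in (0)..x, Real.exp (k * y) * h y :=
    intervalIntegral.continuous_primitive (fun a b => by
      rw [intervalIntegrable_iff]
      exact (hq (max a b)).mono_set fun y hy => hy.2) 0
  fun_prop

lemma hasDerivAt_leftResolvent (hk : 0 < k) (hc : Continuous h) (hb : ∀ x, |h x| ≤ M) (x : ℝ) :
    HasDerivAt (leftResolvent k h) (h x - k * leftResolvent k h x) x := by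
  have hq := integrableOn_exp_mul_bounded hk hc.measurable hb
  have hcont : Continuous fun y => Real.exp (k * y) * h y := by fun_prop
  have h1 : HasDerivAt (fun x => ∫ y in Iic x, Real.exp (k * y) * h y)
      (Real.exp (k * x) * h x) x := by
    rw [funext (setIntegral_Iic_eq_add hq)]
    exact (intervalIntegral.integral_hasDerivAt_right (hcont.intervalIntegrable _ _)
      hcont.stronglyMeasurable.stronglyMeasurableAtFilter hcont.continuousAt).const_add _
  have h2 : HasDerivAt (fun x => Real.exp (-(k * x))) (Real.exp (-(k * x)) * (-(k * 1))) x :=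
    (((hasDerivAt_id x).const_mul k).neg).exp
  have : Real.exp (-(k * x)) * Real.exp (k * x) = 1 := by
    rw [← Real.exp_add]; simp
  refine (h2.mul h1).congr_deriv ?_
  rw [leftResolvent]
  linear_combination h x * this

lemma tendsto_leftResolvent {H : ℕ → ℝ → ℝ} (hk : 0 < k) (hm : ∀ n, Measurable (H n))
    (hb : ∀ n x, |H n x| ≤ M) (hl : ∀ x, Tendsto (fun n => H n x) atTop (nhds (h x))) (x : ℝ) :
    Tendsto (fun n => leftResolvent k (H n) x) atTop (nhds (leftResolvent k h x)) := by
  refine Tendsto.const_mul _ (tendsto_integral_of_dominated_convergence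
    (fun y => Real.exp (k * y) * M) (fun n => ?_)
    ((integrableOn_exp_mul_Iic hk x).mul_const M) (fun n => ?_) ?_)
  · exact (integrableOn_exp_mul_bounded hk (hm n) (hb n) x).aestronglyMeasurable
  · refine Eventually.of_forall fun y => ?_
    rw [norm_mul, Real.norm_eq_abs, Real.abs_exp]
    exact mul_le_mul_of_nonneg_left (hb n y) (Real.exp_pos _).le
  · exact Eventually.of_forall fun y => (hl y).const_mul _

lemma lineResolvent_mono {g : ℝ → ℝ} (hk : 0 < k) (hm : Measurable h) (hb : ∀ x, |h x| ≤ M)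
    (gm : Measurable g) (gb : ∀ x, |g x| ≤ M) (hg : ∀ x, h x ≤ g x) (x : ℝ) :
    lineResolvent k h x ≤ lineResolvent k g x :=
  div_le_div_of_nonneg_right
    (add_le_add (leftResolvent_mono hk hm hb gm gb hg x)
      (leftResolvent_mono hk (hm.comp measurable_neg) (fun y => hb (-y))
        (gm.comp measurable_neg) (fun y => gb (-y)) (fun y => hg (-y)) (-x)))
    (by positivity)

lemma lineResolvent_const (hk : 0 < k) (c x : ℝ) :
    lineResolvent k (fun _ => c) x = c / k ^ 2 := by
  rw [lineResolvent, leftResolvent_const hk, leftResolvent_const hk]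
  field_simp
  norm_num

lemma continuous_lineResolvent (hk : 0 < k) (hm : Measurable h) (hb : ∀ x, |h x| ≤ M) :
    Continuous (lineResolvent k h) :=
  ((continuous_leftResolvent hk hm hb).add
    ((continuous_leftResolvent hk (hm.comp measurable_neg) fun y => hb (-y)).comp
      continuous_neg)).div_const _

lemma tendsto_lineResolvent {H : ℕ → ℝ → ℝ} (hk : 0 < k) (hm : ∀ n, Measurable (H n))
    (hb : ∀ n x, |H n x| ≤ M) (hl : ∀ x, Tendsto (fun n => H n x) atTop (nhds (h x))) (x : ℝ) :
    Tendsto (fun n => lineResolvent k (H n) x) atTop (nhds (lineResolvent k h x)) :=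
  ((tendsto_leftResolvent hk hm hb hl x).add
    (tendsto_leftResolvent hk (fun n => (hm n).comp measurable_neg) (fun n y => hb n (-y))
      (fun y => hl (-y)) (-x))).div_const _

lemma exists_hasDerivAt_lineResolvent (hk : 0 < k) (hc : Continuous h) (hb : ∀ x, |h x| ≤ M) :
    ∃ R' : ℝ → ℝ, (∀ x, HasDerivAt (lineResolvent k h) (R' x) x) ∧
      ∀ x, HasDerivAt R' (k ^ 2 * lineResolvent k h x - h x) x := by
  have h1 := hasDerivAt_leftResolvent hk hc hb
  have h2 (x : ℝ) : HasDerivAt (fun x => leftResolvent k (fun y => h (-y)) (-x))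
      (-(h x - k * leftResolvent k (fun y => h (-y)) (-x))) x := by
    have := (hasDerivAt_leftResolvent hk (hc.comp continuous_neg) (fun y => hb (-y)) (-x)).scomp x
      (hasDerivAt_neg x)
    simpa [Function.comp_def] using this
  refine ⟨fun x => (leftResolvent k (fun y => h (-y)) (-x) - leftResolvent k h x) / 2,
    fun x => ?_, fun x => ?_⟩
  · refine (((h1 x).add (h2 x)).div_const (2 * k)).congr_deriv ?_
    field_simp
    ring
  · refine (((h2 x).sub (h1 x)).div_const 2).congr_deriv ?_
    rw [lineResolvent]
    field_simp
    ring

end Resolvent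

lemma tendsto_exp_neg_mul_bounded {k M : ℝ} {v : ℝ → ℝ} (hk : 0 < k) (hb : ∀ x, |v x| ≤ M) :
    Tendsto (fun x => v x * Real.exp (-(k * x))) atTop (nhds 0) := by
  have h : Tendsto (fun x => Real.exp (-(k * x))) atTop (nhds 0) :=
    Real.tendsto_exp_neg_atTop_nhds_zero.comp (tendsto_id.const_mul_atTop hk)
  exact bdd_le_mul_tendsto_zero' M (Eventually.of_forall hb) h

/-- If `v' + k v` satisfies `V' = k V` and `v` is bounded, then `v' + k v = 0`. -/
lemma deriv_add_mul_eq_zero_of_bounded {k M : ℝ} {v v' : ℝ → ℝ} (hk : 0 < k)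
    (hv : ∀ x, HasDerivAt v (v' x) x) (hv' : ∀ x, HasDerivAt v' (k ^ 2 * v x) x)
    (hb : ∀ x, |v x| ≤ M) (x : ℝ) : v' x + k * v x = 0 := by
  have hconst (x y : ℝ) : (v' x + k * v x) * Real.exp (-(k * x)) =
      (v' y + k * v y) * Real.exp (-(k * y)) := by
    have hd (x : ℝ) : HasDerivAt (fun x => (v' x + k * v x) * Real.exp (-(k * x))) 0 x := by
      refine (((hv' x).add ((hv x).const_mul k)).mul
        (((hasDerivAt_id x).const_mul k).neg.exp)).congr_deriv ?_
      simp only [Pi.add_apply, id_eq, mul_one, Pi.neg_apply]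
      ring
    exact is_const_of_deriv_eq_zero (fun x => (hd x).differentiableAt) (fun x => (hd x).deriv) x y
  have hconst' (x y : ℝ) : (v' x - k * v x) * Real.exp (k * x) =
      (v' y - k * v y) * Real.exp (k * y) := by
    have hd (x : ℝ) : HasDerivAt (fun x => (v' x - k * v x) * Real.exp (k * x)) 0 x := by
      refine (((hv' x).sub ((hv x).const_mul k)).mul
        (((hasDerivAt_id x).const_mul k).exp)).congr_deriv ?_
      simp only [Pi.sub_apply, id_eq, mul_one]
      ring
    exact is_const_of_deriv_eq_zero (fun x => (hd x).differentiableAt) (fun x => (hd x).deriv) x y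
  have hlim : Tendsto (fun y => (v' y + k * v y) * Real.exp (-(k * y))) atTop (nhds 0) := by
    have h1 := tendsto_exp_neg_mul_bounded hk hb
    have h2 := tendsto_exp_neg_mul_bounded (k := 2 * k) (by positivity)
      (fun _ : ℝ => le_refl |v' 0 - k * v 0|)
    have h3 := (h1.const_mul (2 * k)).add h2
    simp only [mul_zero, add_zero] at h3
    refine h3.congr fun y => ?_
    have e : Real.exp (-(2 * k * y)) = Real.exp (-(k * y)) * Real.exp (-(k * y)) := by
      rw [← Real.exp_add]; ring_nf
    have e' : Real.exp (k * y) * Real.exp (-(k * y)) = 1 := by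
      rw [← Real.exp_add]; simp
    have c := hconst' y 0
    simp only [mul_zero, Real.exp_zero, mul_one] at c
    rw [e, ← c]
    linear_combination ((v' y - k * v y) * Real.exp (-(k * y))) * e'
  have h0 : (v' x + k * v x) * Real.exp (-(k * x)) = 0 :=
    tendsto_nhds_unique (tendsto_const_nhds.congr fun y => hconst x y) hlim
  exact (mul_eq_zero.mp h0).resolve_right (Real.exp_ne_zero _)

lemma eq_zero_of_bounded_of_deriv_deriv {k M : ℝ} {v v' : ℝ → ℝ} (hk : 0 < k)
    (hv : ∀ x, HasDerivAt v (v' x) x) (hv' : ∀ x, HasDerivAt v' (k ^ 2 * v x) x)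
    (hb : ∀ x, |v x| ≤ M) (x : ℝ) : v x = 0 := by
  have h1 := deriv_add_mul_eq_zero_of_bounded hk hv hv' hb x
  have h2 := deriv_add_mul_eq_zero_of_bounded (v := fun y => v (-y)) (v' := fun y => -v' (-y)) hk
    (fun y => by simpa [Function.comp_def] using (hv (-y)).scomp y (hasDerivAt_neg y))
    (fun y => (((hv' (-y)).scomp y (hasDerivAt_neg y)).neg).congr_deriv (by simp))
    (fun y => hb (-y)) (-x)
  simp only [neg_neg] at h2
  have : 2 * k * v x = 0 := by linarith
  exact (mul_eq_zero.mp this).resolve_left (by positivity)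

lemma eq_lineResolvent_of_bounded {k M N : ℝ} {h v v' : ℝ → ℝ} (hk : 0 < k) (hc : Continuous h)
    (hb : ∀ x, |h x| ≤ M) (hv : ∀ x, HasDerivAt v (v' x) x)
    (hv' : ∀ x, HasDerivAt v' (k ^ 2 * v x - h x) x) (hN : ∀ x, |v x| ≤ N) (x : ℝ) :
    v x = lineResolvent k h x := by
  obtain ⟨R', hR, hR'⟩ := exists_hasDerivAt_lineResolvent hk hc hb
  have hRb (x : ℝ) : |lineResolvent k h x| ≤ M / k ^ 2 := by
    have hMm : ∀ y : ℝ, |M| ≤ |M| := fun _ => le_rfl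
    have hb' : ∀ y, |h y| ≤ |M| := fun y => (hb y).trans (le_abs_self M)
    rw [abs_le, ← neg_div, ← lineResolvent_const hk, ← lineResolvent_const hk M x]
    exact ⟨lineResolvent_mono hk measurable_const (fun _ => (abs_neg M).le) hc.measurable hb'
        (fun y => (abs_le.mp (hb y)).1) x,
      lineResolvent_mono hk hc.measurable hb' measurable_const hMm
        (fun y => (abs_le.mp (hb y)).2) x⟩
  refine sub_eq_zero.mp (eq_zero_of_bounded_of_deriv_deriv (v := fun x => v x - lineResolvent k h x)
    (v' := fun x => v' x - R' x) (M := N + M / k ^ 2) hk (fun x => (hv x).sub (hR x))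
    (fun x => ((hv' x).sub (hR' x)).congr_deriv (by ring)) (fun x => ?_) x)
  exact (abs_sub _ _).trans (add_le_add (hN x) (hRb x))

/-- Monotone iteration: the minimal solution of `w'' = k² w - G(x,w)` between ordered constant
sub- and supersolutions. -/
lemma exists_minimal_solution {k a b : ℝ} {G : ℝ → ℝ → ℝ} (hk : 0 < k)
    (hG : Continuous (Function.uncurry G)) (hmono : ∀ x, Monotone (G x))
    (ha : ∀ x u, k ^ 2 * a ≤ G x u) (hb : ∀ x u, G x u ≤ k ^ 2 * b) :
    ∃ w w' : ℝ → ℝ, (∀ x, HasDerivAt w (w' x) x) ∧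
      (∀ x, HasDerivAt w' (k ^ 2 * w x - G x (w x)) x) ∧ (∀ x, a ≤ w x ∧ w x ≤ b) ∧
      ∀ v v' : ℝ → ℝ, (∀ x, HasDerivAt v (v' x) x) →
        (∀ x, HasDerivAt v' (k ^ 2 * v x - G x (v x)) x) → (∀ x, a ≤ v x ∧ v x ≤ b) →
        ∀ x, w x ≤ v x := by
  set M := max |k ^ 2 * a| |k ^ 2 * b|
  have hM (x u : ℝ) : |G x u| ≤ M := abs_le_max_abs_abs (ha x u) (hb x u)
  have hmeas {w : ℝ → ℝ} (hw : Measurable w) : Measurable fun x => G x (w x) :=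
    hG.measurable.comp (measurable_id.prodMk hw)
  let T : (ℝ → ℝ) → ℝ → ℝ := fun w => lineResolvent k fun x => G x (w x)
  have hT {w : ℝ → ℝ} (hw : Measurable w) : Continuous (T w) :=
    continuous_lineResolvent hk (hmeas hw) fun x => hM x _
  have hTmono {w v : ℝ → ℝ} (hw : Measurable w) (hv : Measurable v) (hwv : ∀ x, w x ≤ v x)
      (x : ℝ) : T w x ≤ T v x :=
    lineResolvent_mono hk (hmeas hw) (fun x => hM x _) (hmeas hv) (fun x => hM x _)
      (fun x => hmono x (hwv x)) x
  have hconst (c x : ℝ) : lineResolvent k (fun _ => k ^ 2 * c) x = c := by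
    rw [lineResolvent_const hk]; field_simp
  have hTa {w : ℝ → ℝ} (hw : Measurable w) (x : ℝ) : a ≤ T w x := by
    conv_lhs => rw [← hconst a x]
    exact lineResolvent_mono hk measurable_const (fun _ => le_max_left _ _) (hmeas hw)
      (fun x => hM x _) (fun x => ha x _) x
  have hTb {w : ℝ → ℝ} (hw : Measurable w) (x : ℝ) : T w x ≤ b := by
    conv_rhs => rw [← hconst b x]
    exact lineResolvent_mono hk (hmeas hw) (fun x => hM x _) measurable_const
      (fun _ => le_max_right _ _) (fun x => hb x _) x
  let W : ℕ → ℝ → ℝ := fun n => T^[n] fun _ => a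
  have hW (n : ℕ) : W (n + 1) = T (W n) := Function.iterate_succ_apply' _ _ _
  have hWm (n : ℕ) : Measurable (W n) := by
    induction n with
    | zero => exact measurable_const
    | succ n ih => rw [hW]; exact (hT ih).measurable
  have hab : a ≤ b := le_of_mul_le_mul_left ((ha 0 0).trans (hb 0 0)) (by positivity)
  have hWab (n : ℕ) (x : ℝ) : a ≤ W n x ∧ W n x ≤ b := by
    cases n with
    | zero => exact ⟨le_rfl, hab⟩
    | succ n => rw [hW]; exact ⟨hTa (hWm n) x, hTb (hWm n) x⟩
  have hWs (n : ℕ) : ∀ x, W n x ≤ W (n + 1) x := by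
    induction n with
    | zero => exact fun x => (hWab 1 x).1
    | succ n ih =>
      intro x
      rw [hW, hW (n + 1)]
      exact hTmono (hWm n) (hWm (n + 1)) ih x
  have hbdd (x : ℝ) : BddAbove (range fun n => W n x) :=
    ⟨b, by rintro _ ⟨n, rfl⟩; exact (hWab n x).2⟩
  let w : ℝ → ℝ := fun x => ⨆ n, W n x
  have hlim (x : ℝ) : Tendsto (fun n => W n x) atTop (nhds (w x)) :=
    tendsto_atTop_ciSup (monotone_nat_of_le_succ fun n => hWs n x) (hbdd x)
  have hwm : Measurable w := measurable_of_tendsto_metrizable hWm (tendsto_pi_nhds.mpr hlim)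
  have hfix : w = T w := by
    ext x
    have h1 := (hlim x).comp (tendsto_add_atTop_nat 1)
    have h2 : Tendsto (fun n => T (W n) x) atTop (nhds (T w x)) :=
      tendsto_lineResolvent hk (fun n => hmeas (hWm n)) (fun n y => hM y _)
        (fun y => ((hG.comp (Continuous.prodMk_right y)).tendsto (w y)).comp (hlim y)) x
    refine tendsto_nhds_unique h1 (h2.congr fun n => ?_)
    simp only [Function.comp_apply, hW]
  have hwc : Continuous w := hfix ▸ hT hwm
  have hGw {v : ℝ → ℝ} (hv : Continuous v) : Continuous fun x => G x (v x) :=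
    hG.comp (continuous_id.prodMk hv)
  obtain ⟨w', hw1, hw2⟩ := exists_hasDerivAt_lineResolvent hk (hGw hwc) fun x => hM x _
  refine ⟨w, w', fun x => ?_, fun x => ?_, fun x => ?_, fun v v' hv hv' hvab x => ?_⟩
  · have := hw1 x
    change HasDerivAt (T w) _ _ at this
    rwa [← hfix] at this
  · have := hw2 x
    change HasDerivAt _ (k ^ 2 * T w x - _) _ at this
    rwa [← hfix] at this
  · rw [hfix]; exact ⟨hTa hwm x, hTb hwm x⟩
  · have hvc : Continuous v := continuous_iff_continuousAt.mpr fun x => (hv x).continuousAt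
    have hvT : v = T v := funext <| eq_lineResolvent_of_bounded hk (hGw hvc) (fun x => hM x _) hv hv'
      (fun x => abs_le_max_abs_abs (hvab x).1 (hvab x).2)
    have hle (n : ℕ) : ∀ x, W n x ≤ v x := by
      induction n with
      | zero => exact fun x => (hvab x).1
      | succ n ih =>
        intro x
        rw [hW, hvT]
        exact hTmono (hWm n) hvc.measurable ih x
    exact ciSup_le fun n => hle n x

lemma exists_maximal_solution {k a b : ℝ} {G : ℝ → ℝ → ℝ} (hk : 0 < k)
    (hG : Continuous (Function.uncurry G)) (hmono : ∀ x, Monotone (G x))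
    (ha : ∀ x u, k ^ 2 * a ≤ G x u) (hb : ∀ x u, G x u ≤ k ^ 2 * b) :
    ∃ w w' : ℝ → ℝ, (∀ x, HasDerivAt w (w' x) x) ∧
      (∀ x, HasDerivAt w' (k ^ 2 * w x - G x (w x)) x) ∧ (∀ x, a ≤ w x ∧ w x ≤ b) ∧
      ∀ v v' : ℝ → ℝ, (∀ x, HasDerivAt v (v' x) x) →
        (∀ x, HasDerivAt v' (k ^ 2 * v x - G x (v x)) x) → (∀ x, a ≤ v x ∧ v x ≤ b) →
        ∀ x, v x ≤ w x := by
  obtain ⟨w, w', h1, h2, h3, h4⟩ := exists_minimal_solution (a := -b) (b := -a)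
    (G := fun x u => -G x (-u)) hk
    (hG.comp (continuous_fst.prodMk continuous_snd.neg)).neg
    (fun x u v huv => neg_le_neg (hmono x (neg_le_neg huv)))
    (fun x u => by linarith [hb x (-u)]) (fun x u => by linarith [ha x (-u)])
  refine ⟨fun x => -w x, fun x => -w' x, fun x => (h1 x).neg,
    fun x => (h2 x).neg.congr_deriv (by ring),
    fun x => ⟨by linarith [(h3 x).2], by linarith [(h3 x).1]⟩, fun v v' hv hv' hvab x => ?_⟩
  have := h4 (fun x => -v x) (fun x => -v' x) (fun x => (hv x).neg)
    (fun x => (hv' x).neg.congr_deriv (by simp only [neg_neg]; ring))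
    (fun x => ⟨by linarith [(hvab x).2], by linarith [(hvab x).1]⟩) x
  linarith

lemma rpow_sub_one_mul_le_rpow_sub_rpow {m α s t : ℝ} (hm : 1 ≤ m) (hα : 0 < α) (hs : α ≤ s)
    (hst : s ≤ t) : α ^ (m - 1) * (t - s) ≤ t ^ m - s ^ m := by
  have hs0 : 0 < s := hα.trans_le hs
  have hpow {r : ℝ} (hr : 0 < r) : r ^ m = r ^ (m - 1) * r := by
    rw [← Real.rpow_add_one hr.ne']; ring_nf
  have h1 : α ^ (m - 1) ≤ s ^ (m - 1) := Real.rpow_le_rpow hα.le hs (by linarith)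
  have h2 : s ^ (m - 1) ≤ t ^ (m - 1) := Real.rpow_le_rpow hs0.le hst (by linarith)
  rw [hpow hs0, hpow (hs0.trans_le hst)]
  nlinarith [mul_le_mul_of_nonneg_right h1 (sub_nonneg.mpr hst),
    mul_le_mul_of_nonneg_right h2 (hs0.trans_le hst).le]

lemma exists_monotoneOn_add_mul_rpow {m α β : ℝ} {φ : ℝ → ℝ → ℝ} (hm : 1 ≤ m) (hα : 0 < α)
    (hφ : ContDiff ℝ 1 (Function.uncurry φ)) (hper : ∀ x u, φ (x + 1) u = φ x u) :
    ∃ k > 0, ∀ x, MonotoneOn (fun u => φ x u + k ^ 2 * u ^ m) (Icc α β) := by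
  obtain ⟨L, hL⟩ := hφ.contDiffOn.exists_lipschitzOnWith (s := Icc (0 : ℝ) 1 ×ˢ Icc α β) one_ne_zero
    ((convex_Icc _ _).prod (convex_Icc _ _)) (isCompact_Icc.prod isCompact_Icc)
  have hA : 0 < α ^ (m - 1) := Real.rpow_pos_of_pos hα _
  refine ⟨√(L / α ^ (m - 1) + 1), Real.sqrt_pos.mpr (by positivity), fun x s hs t ht hst => ?_⟩
  rw [Real.sq_sqrt (by positivity)]
  obtain ⟨y, hy, hxy⟩ := Function.Periodic.exists_mem_Ico₀ (f := φ) (fun x => funext (hper x))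
    one_pos x
  have h1 : |φ x t - φ x s| ≤ L * (t - s) := by
    have := hL.dist_le_mul (y, t) ⟨Ico_subset_Icc_self hy, ht⟩ (y, s) ⟨Ico_subset_Icc_self hy, hs⟩
    rw [Prod.dist_eq, dist_self, max_eq_right dist_nonneg, Real.dist_eq, Real.dist_eq,
      abs_of_nonneg (sub_nonneg.mpr hst)] at this
    simpa [Function.uncurry, hxy] using this
  have h2 := rpow_sub_one_mul_le_rpow_sub_rpow hm hα hs.1 hst
  have h3 : L * (t - s) ≤ (L / α ^ (m - 1) + 1) * (t ^ m - s ^ m) :=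
    calc L * (t - s) = L / α ^ (m - 1) * (α ^ (m - 1) * (t - s)) := by field_simp
      _ ≤ (L / α ^ (m - 1) + 1) * (t ^ m - s ^ m) :=
        mul_le_mul (by linarith) h2 (mul_nonneg hA.le (sub_nonneg.mpr hst)) (by positivity)
  simp only
  linarith [(abs_le.mp h1).1]

lemma contDiff_two_of_hasDerivAt {w w' w'' : ℝ → ℝ} (h1 : ∀ x, HasDerivAt w (w' x) x)
    (h2 : ∀ x, HasDerivAt w' (w'' x) x) (h3 : Continuous w'') : ContDiff ℝ 2 w := by
  have e1 : deriv w = w' := funext fun x => (h1 x).deriv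
  have e2 : deriv w' = w'' := funext fun x => (h2 x).deriv
  rw [show (2 : WithTop ℕ∞) = 1 + 1 by norm_num, contDiff_succ_iff_deriv, e1]
  refine ⟨fun x => (h1 x).differentiableAt, by simp, ?_⟩
  rw [contDiff_one_iff_deriv, e2]
  exact ⟨fun x => (h2 x).differentiableAt, h3⟩

lemma ContDiff.hasDerivAt_deriv_deriv {w : ℝ → ℝ} (h : ContDiff ℝ 2 w) (x : ℝ) :
    HasDerivAt w (deriv w x) x ∧ HasDerivAt (deriv w) (deriv (deriv w) x) x := by
  rw [show (2 : WithTop ℕ∞) = 1 + 1 by norm_num, contDiff_succ_iff_deriv] at h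
  exact ⟨(h.1 x).hasDerivAt, (h.2.2.differentiable one_ne_zero x).hasDerivAt⟩

section Stationary

variable {m α β : ℝ} {φ : ℝ → ℝ → ℝ}

/-- `C²` solutions of `(p^m)'' + φ(x,p) = 0` on the line with values in `[α,β]`. -/
def StationaryBetween (m α β : ℝ) (φ : ℝ → ℝ → ℝ) (p : ℝ → ℝ) : Prop :=
  ContDiff ℝ 2 p ∧ (∀ x, α ≤ p x ∧ p x ≤ β) ∧
    ∀ x, deriv (deriv fun y => p y ^ m) x + φ x (p x) = 0

lemma StationaryBetween.comp_add_const {p : ℝ → ℝ} {c : ℝ} (hp : StationaryBetween m α β φ p)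
    (hc : ∀ x u, φ (x + c) u = φ x u) : StationaryBetween m α β φ fun x => p (x + c) := by
  refine ⟨hp.1.comp (contDiff_id.add contDiff_const), fun x => hp.2.1 (x + c), fun x => ?_⟩
  have h1 : deriv (fun y => p (y + c) ^ m) = fun y => deriv (fun z => p z ^ m) (y + c) :=
    funext fun y => deriv_comp_add_const (fun z => p z ^ m) c y
  rw [h1, deriv_comp_add_const (deriv fun z => p z ^ m), ← hc]
  exact hp.2.2 (x + c)

/-- `φ(x, u^{1/m}) + k² u`, with `u` truncated to `[α^m, β^m]`. -/
def truncatedReaction (m α β k : ℝ) (φ : ℝ → ℝ → ℝ) (x u : ℝ) : ℝ :=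
  φ x (max (α ^ m) (min (β ^ m) u) ^ m⁻¹) + k ^ 2 * max (α ^ m) (min (β ^ m) u)

lemma rpow_inv_mem_Icc (hm : 1 ≤ m) (hα : 0 < α) (hαβ : α ≤ β) {u : ℝ}
    (hu : u ∈ Icc (α ^ m) (β ^ m)) : u ^ m⁻¹ ∈ Icc α β := by
  have hm0 : 0 < m := by linarith
  have hu0 : 0 ≤ u := (Real.rpow_pos_of_pos hα m).le.trans hu.1
  exact ⟨(Real.le_rpow_inv_iff_of_pos hα.le hu0 hm0).mpr hu.1,
    (Real.rpow_inv_le_iff_of_pos hu0 (hα.le.trans hαβ) hm0).mpr hu.2⟩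

lemma truncatedReaction_rpow (hm : 1 ≤ m) (hα : 0 < α) {k x s : ℝ} (hs : s ∈ Icc α β) :
    truncatedReaction m α β k φ x (s ^ m) = φ x s + k ^ 2 * s ^ m := by
  have hs0 : 0 ≤ s := hα.le.trans hs.1
  rw [truncatedReaction, min_eq_right (Real.rpow_le_rpow hs0 hs.2 (by linarith)),
    max_eq_right (Real.rpow_le_rpow hα.le hs.1 (by linarith)),
    Real.rpow_rpow_inv hs0 (by linarith)]

lemma truncate_rpow_inv_mem_Icc (hm : 1 ≤ m) (hα : 0 < α) (hαβ : α ≤ β) (u : ℝ) :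
    max (α ^ m) (min (β ^ m) u) ^ m⁻¹ ∈ Icc α β ∧
      (max (α ^ m) (min (β ^ m) u) ^ m⁻¹) ^ m = max (α ^ m) (min (β ^ m) u) := by
  refine ⟨rpow_inv_mem_Icc hm hα hαβ ⟨le_max_left _ _, max_le
    (Real.rpow_le_rpow hα.le hαβ (by linarith)) (min_le_left _ _)⟩, ?_⟩
  exact Real.rpow_inv_rpow ((Real.rpow_pos_of_pos hα m).le.trans (le_max_left _ _)) (by linarith)

lemma StationaryBetween.rpow_solution (hm : 1 ≤ m) (hα : 0 < α) {k : ℝ} {p : ℝ → ℝ}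
    (hp : StationaryBetween m α β φ p) :
    ∃ v' : ℝ → ℝ, (∀ x, HasDerivAt (fun y => p y ^ m) (v' x) x) ∧
      (∀ x, HasDerivAt v' (k ^ 2 * p x ^ m - truncatedReaction m α β k φ x (p x ^ m)) x) ∧
      ∀ x, α ^ m ≤ p x ^ m ∧ p x ^ m ≤ β ^ m := by
  have hp0 (x : ℝ) : 0 < p x := hα.trans_le (hp.2.1 x).1
  have hd := (hp.1.rpow_const_of_ne (p := m) fun x => (hp0 x).ne').hasDerivAt_deriv_deriv
  refine ⟨_, fun x => (hd x).1, fun x => (hd x).2.congr_deriv ?_, fun x =>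
    ⟨Real.rpow_le_rpow hα.le (hp.2.1 x).1 (by linarith),
      Real.rpow_le_rpow (hp0 x).le (hp.2.1 x).2 (by linarith)⟩⟩
  rw [truncatedReaction_rpow hm hα (hp.2.1 x)]
  linarith [hp.2.2 x]

lemma stationaryBetween_rpow_inv (hm : 1 ≤ m) (hα : 0 < α) (hαβ : α ≤ β) {k : ℝ} {w w' : ℝ → ℝ}
    (hG : Continuous (Function.uncurry (truncatedReaction m α β k φ)))
    (hw : ∀ x, HasDerivAt w (w' x) x)
    (hw' : ∀ x, HasDerivAt w' (k ^ 2 * w x - truncatedReaction m α β k φ x (w x)) x)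
    (hwab : ∀ x, α ^ m ≤ w x ∧ w x ≤ β ^ m) :
    StationaryBetween m α β φ fun x => w x ^ m⁻¹ := by
  have hwc : Continuous w := continuous_iff_continuousAt.mpr fun x => (hw x).continuousAt
  have hw0 (x : ℝ) : 0 < w x := (Real.rpow_pos_of_pos hα m).trans_le (hwab x).1
  have hpow (x : ℝ) : (w x ^ m⁻¹) ^ m = w x := Real.rpow_inv_rpow (hw0 x).le (by linarith)
  have hmem (x : ℝ) : w x ^ m⁻¹ ∈ Icc α β := rpow_inv_mem_Icc hm hα hαβ (hwab x)
  refine ⟨?_, hmem, fun x => ?_⟩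
  · refine (contDiff_two_of_hasDerivAt hw hw' ?_).rpow_const_of_ne fun x => (hw0 x).ne'
    exact (hwc.const_mul _).sub (hG.comp (continuous_id.prodMk hwc))
  · have h := truncatedReaction_rpow (k := k) (x := x) (φ := φ) hm hα (hmem x)
    rw [hpow x] at h
    simp_rw [hpow]
    rw [show deriv w = w' from funext fun x => (hw x).deriv, (hw' x).deriv, h]
    ring

lemma continuous_truncatedReaction (hα : 0 < α) {k : ℝ}
    (hφ : Continuous (Function.uncurry φ)) :
    Continuous (Function.uncurry (truncatedReaction m α β k φ)) := by
  have hc : Continuous fun q : ℝ × ℝ => max (α ^ m) (min (β ^ m) q.2) := by fun_prop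
  refine (hφ.comp (continuous_fst.prodMk (hc.rpow_const fun q => ?_))).add (hc.const_mul _)
  exact Or.inl ((Real.rpow_pos_of_pos hα m).trans_le (le_max_left _ _)).ne'

/-- Extremal stationary solutions between the constant sub- and supersolutions `α` and `β`. -/
lemma exists_extremal_stationaryBetween (hm : 1 ≤ m) (hα : 0 < α) (hαβ : α ≤ β)
    (hφ : ContDiff ℝ 1 (Function.uncurry φ)) (hper : ∀ x u, φ (x + 1) u = φ x u)
    (hφα : ∀ x, 0 ≤ φ x α) (hφβ : ∀ x, φ x β ≤ 0) :
    ∃ p₁ p₂ : ℝ → ℝ, StationaryBetween m α β φ p₁ ∧ StationaryBetween m α β φ p₂ ∧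
      ∀ p, StationaryBetween m α β φ p → ∀ x, p₁ x ≤ p x ∧ p x ≤ p₂ x := by
  obtain ⟨k, hk, hmono⟩ := exists_monotoneOn_add_mul_rpow (β := β) hm hα hφ hper
  have hm0 : 0 < m := by linarith
  have hGc := continuous_truncatedReaction (m := m) (β := β) (k := k) hα hφ.continuous
  have hclamp := truncate_rpow_inv_mem_Icc hm hα hαβ
  have hG (x u : ℝ) : truncatedReaction m α β k φ x u = (fun s => φ x s + k ^ 2 * s ^ m)
      (max (α ^ m) (min (β ^ m) u) ^ m⁻¹) := by
    simp only [truncatedReaction, (hclamp u).2]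
  have hGmono (x : ℝ) : Monotone (truncatedReaction m α β k φ x) := fun u v huv => by
    rw [hG, hG]
    refine hmono x (hclamp u).1 (hclamp v).1 (Real.rpow_le_rpow ?_ ?_ (by positivity))
    · exact (Real.rpow_pos_of_pos hα m).le.trans (le_max_left _ _)
    · exact max_le_max le_rfl (min_le_min le_rfl huv)
  have hGa (x u : ℝ) : k ^ 2 * α ^ m ≤ truncatedReaction m α β k φ x u := by
    have := hmono x (left_mem_Icc.mpr hαβ) (hclamp u).1 (hclamp u).1.1
    rw [hG]
    linarith [hφα x]
  have hGb (x u : ℝ) : truncatedReaction m α β k φ x u ≤ k ^ 2 * β ^ m := by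
    have := hmono x (hclamp u).1 (right_mem_Icc.mpr hαβ) (hclamp u).1.2
    rw [hG]
    linarith [hφβ x]
  obtain ⟨w₁, w₁', h1, h1', hab1, hmin⟩ := exists_minimal_solution hk hGc hGmono hGa hGb
  obtain ⟨w₂, w₂', h2, h2', hab2, hmax⟩ := exists_maximal_solution hk hGc hGmono hGa hGb
  refine ⟨_, _, stationaryBetween_rpow_inv hm hα hαβ hGc h1 h1' hab1,
    stationaryBetween_rpow_inv hm hα hαβ hGc h2 h2' hab2, fun p hp x => ?_⟩
  obtain ⟨v', hv, hv', hvab⟩ := hp.rpow_solution (k := k) hm hα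
  have hp0 : 0 ≤ p x := hα.le.trans (hp.2.1 x).1
  have ha := Real.rpow_pos_of_pos hα m
  exact ⟨(Real.rpow_inv_le_iff_of_pos (ha.le.trans (hab1 x).1) hp0 hm0).mpr
      (hmin _ v' hv hv' hvab x),
    (Real.le_rpow_inv_iff_of_pos hp0 (ha.le.trans (hab2 x).1) hm0).mpr (hmax _ v' hv hv' hvab x)⟩

end Stationary

lemma kappaMin_le_and_le_kappaMax {κ : ℝ → ℝ} (hc : Continuous κ) (hper : ∀ x, κ (x + 1) = κ x)
    (x : ℝ) : kappaMin κ ≤ κ x ∧ κ x ≤ kappaMax κ := by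
  obtain ⟨y, hy, hxy⟩ := Function.Periodic.exists_mem_Ico₀ (f := κ) hper one_pos x
  have hK : IsCompact (κ '' Icc 0 1) := isCompact_Icc.image hc
  have hmem : κ x ∈ κ '' Icc 0 1 := ⟨y, Ico_subset_Icc_self hy, hxy.symm⟩
  exact ⟨csInf_le hK.bddBelow hmem, le_csSup hK.bddAbove hmem⟩

lemma lt_kappaMin {κ : ℝ → ℝ} {θ : ℝ} (hc : Continuous κ) (hθ : ∀ x, θ < κ x) :
    θ < kappaMin κ := by
  obtain ⟨y, -, hy⟩ := (isCompact_Icc.image hc).sInf_mem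
    ((nonempty_Icc.mpr (zero_le_one (α := ℝ))).image κ)
  exact (hθ y).trans_eq hy

/-- Under (F1), the PME has minimal and maximal 1-periodic stationary
solutions `p₁ ≤ p₂` in the range `[κ₀, κ⁰]`. -/
theorem exists_min_max_periodic_stationary
    (m : ℝ) (hm : 1 < m) (f : ℝ → ℝ → ℝ) (κ : ℝ → ℝ) (θ : ℝ)
    (hF1 : CondF1 f κ θ) :
    ∃ p₁ p₂ : ℝ → ℝ,
      ContDiff ℝ 2 p₁ ∧ ContDiff ℝ 2 p₂ ∧
      (∀ x, p₁ (x + 1) = p₁ x) ∧ (∀ x, p₂ (x + 1) = p₂ x) ∧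
      (∀ x, p₁ x ≤ p₂ x) ∧
      (∀ x, kappaMin κ ≤ p₁ x ∧ p₁ x ≤ kappaMax κ) ∧
      (∀ x, kappaMin κ ≤ p₂ x ∧ p₂ x ≤ kappaMax κ) ∧
      (∀ x, deriv (deriv (fun y => p₁ y ^ m)) x + f x (p₁ x) * (κ x - p₁ x) = 0) ∧
      (∀ x, deriv (deriv (fun y => p₂ y ^ m)) x + f x (p₂ x) * (κ x - p₂ x) = 0) ∧
      ∀ p : ℝ → ℝ, ContDiff ℝ 2 p →
        (∀ x, kappaMin κ ≤ p x ∧ p x ≤ kappaMax κ) →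
        (∀ x, deriv (deriv (fun y => p y ^ m)) x + f x (p x) * (κ x - p x) = 0) →
        ∀ x, p₁ x ≤ p x ∧ p x ≤ p₂ x := by
  obtain ⟨hf, hκ, hfper, hκper, -, hθ, hfpos, hκθ⟩ := hF1
  have hbd := kappaMin_le_and_le_kappaMax hκ.continuous hκper
  have hmin := lt_kappaMin hκ.continuous hκθ
  have hle : kappaMin κ ≤ kappaMax κ := (hbd 0).1.trans (hbd 0).2
  have hper (x u : ℝ) : f (x + 1) u * (κ (x + 1) - u) = f x u * (κ x - u) := by
    rw [hfper, hκper]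
  have hper' (x u : ℝ) : f (x + -1) u * (κ (x + -1) - u) = f x u * (κ x - u) := by
    rw [← hper (x + -1), neg_add_cancel_right]
  have hφ : ContDiff ℝ 2 (Function.uncurry fun x u => f x u * (κ x - u)) :=
    hf.mul ((hκ.comp contDiff_fst).sub contDiff_snd)
  obtain ⟨p₁, p₂, h1, h2, hext⟩ := exists_extremal_stationaryBetween
    (φ := fun x u => f x u * (κ x - u)) hm.le (hθ.trans hmin) hle (hφ.of_le one_le_two) hper
    (fun x => mul_nonneg (hfpos x _ hmin).le (sub_nonneg.mpr (hbd x).1))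
    (fun x => mul_nonpos_of_nonneg_of_nonpos (hfpos x _ (hmin.trans_le hle)).le
      (sub_nonpos.mpr (hbd x).2))
  refine ⟨p₁, p₂, h1.1, h2.1, fun x => le_antisymm ?_ ?_, fun x => le_antisymm ?_ ?_,
    fun x => (hext p₂ h2 x).1, h1.2.1, h2.2.1, h1.2.2, h2.2.2,
    fun p hp hpb hps => hext p ⟨hp, hpb, hps⟩⟩
  · simpa using (hext _ (h1.comp_add_const hper') (x + 1)).1
  · exact (hext _ (h1.comp_add_const hper) x).1
  · exact (hext _ (h2.comp_add_const hper) x).2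
  · simpa using (hext _ (h2.comp_add_const hper') (x + 1)).2
end
end

section
/- Assume (F1) and (F2). Let p₂ ∈ C²(ℝ) be the maximal 1-periodic stationary solution of the PME in the range [κ₀, κ⁰], i.e. κ₀ ≤ p₂ ≤ κ⁰, (p₂^m)″ + f(x,p₂)(κ(x) − p₂) = 0 on ℝ, and p̃ ≤ p₂ for every C² stationary solution p̃ with κ₀ ≤ p̃ ≤ κ⁰ on ℝ. Then p₂(x) > φ₀(x − x₀) for every x₀ ∈ ℝ and every x ∈ [x₀ − l₀, x₀ + l₀]. -/
open MeasureTheory Set Filter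

noncomputable section

/-- A function with nonpositive Cauchy data at `a` that satisfies `v'' ≤ C v` wherever it is
increasing stays nonpositive to the right of `a`. -/
lemma nonpos_of_second_deriv_le_of_deriv_pos {v v' v'' : ℝ → ℝ} {a b C : ℝ} (hab : a ≤ b)
    (hC : 0 ≤ C) (hv : ∀ x ∈ Icc a b, HasDerivAt v (v' x) x)
    (hv' : ∀ x ∈ Icc a b, HasDerivAt v' (v'' x) x) (hva : v a ≤ 0) (hva' : v' a ≤ 0)
    (h : ∀ x ∈ Icc a b, 0 < v' x → v'' x ≤ C * v x) : v b ≤ 0 := by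
  set K : ℝ := C + 1 with hK
  have hKpos : 0 < K := by positivity
  have hexp : ∀ x, HasDerivAt (fun x => Real.exp (K * x)) (K * Real.exp (K * x)) x := fun x => by
    simpa [mul_comm] using ((hasDerivAt_id x).const_mul K).exp
  have hexpn : ∀ x, HasDerivAt (fun x => Real.exp (-(K * x))) (-(K * Real.exp (-(K * x)))) x :=
    fun x => by simpa [mul_comm] using ((hasDerivAt_id x).const_mul K).neg.exp
  have hQ : ∀ x ∈ Icc a b, HasDerivAt (fun x => v' x * Real.exp (-(K * x)))
      (v'' x * Real.exp (-(K * x)) + v' x * (-(K * Real.exp (-(K * x))))) x :=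
    fun x hx => (hv' x hx).mul (hexpn x)
  obtain ⟨t, ht, hmax⟩ := isCompact_Icc.exists_isMaxOn (nonempty_Icc.2 hab)
    (fun x hx => (hQ x hx).continuousAt.continuousWithinAt)
  set S : ℝ := v' t * Real.exp (-(K * t)) with hS
  have hexp_mul : ∀ x, Real.exp (-(K * x)) * Real.exp (K * x) = 1 := fun x => by
    rw [← Real.exp_add]; simp
  have hle : ∀ x ∈ Icc a b, v' x ≤ S * Real.exp (K * x) := fun x hx => by
    have h1 : v' x * Real.exp (-(K * x)) ≤ S := hmax hx
    have h2 := mul_le_mul_of_nonneg_right h1 (Real.exp_pos (K * x)).le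
    rwa [mul_assoc, hexp_mul, mul_one] at h2
  have hSle : S ≤ 0 := by
    by_contra! hSpos
    have hvt : v' t = S * Real.exp (K * t) := by
      rw [hS, mul_assoc, hexp_mul, mul_one]
    have hvtpos : 0 < v' t := by rw [hvt]; positivity
    have hat : a < t := lt_of_le_of_ne ht.1 (by rintro rfl; linarith)
    have hvle : v t ≤ S / K * Real.exp (K * t) := by
      have hderiv : ∀ x ∈ Icc a t, HasDerivAt (fun x => v x - S / K * Real.exp (K * x))
          (v' x - S / K * (K * Real.exp (K * x))) x := fun x hx =>
        (hv x ⟨hx.1, hx.2.trans ht.2⟩).sub ((hexp x).const_mul _)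
      have hanti : AntitoneOn (fun x => v x - S / K * Real.exp (K * x)) (Icc a t) := by
        refine antitoneOn_of_deriv_nonpos (convex_Icc a t)
          (fun x hx => (hderiv x hx).continuousAt.continuousWithinAt)
          (fun x hx => (hderiv x (interior_subset hx)).differentiableAt.differentiableWithinAt)
          fun x hx => ?_
        have hx' := interior_subset hx
        rw [(hderiv x hx').deriv, ← mul_assoc, div_mul_cancel₀ _ hKpos.ne']
        linarith [hle x ⟨hx'.1, hx'.2.trans ht.2⟩]
      have h1 := hanti (left_mem_Icc.2 hat.le) (right_mem_Icc.2 hat.le) hat.le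
      have h2 : 0 < S / K * Real.exp (K * a) := by positivity
      simp only at h1
      linarith
    have hQt : 0 ≤ v'' t * Real.exp (-(K * t)) + v' t * (-(K * Real.exp (-(K * t)))) := by
      refine ge_of_tendsto ((hasDerivAt_iff_tendsto_slope.1 (hQ t ht)).mono_left
        (nhdsWithin_mono t (s := Iio t) (fun x hx => (mem_Iio.1 hx).ne))) ?_
      filter_upwards [Ioo_mem_nhdsLT hat] with x hx
      rw [slope_def_field]
      have : v' x * Real.exp (-(K * x)) ≤ S := hmax ⟨hx.1.le, hx.2.le.trans ht.2⟩
      exact div_nonneg_of_nonpos (by linarith) (by linarith [hx.2])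
    have h1 : K * v' t ≤ v'' t := by
      have := Real.exp_pos (-(K * t))
      by_contra! hlt
      nlinarith [mul_lt_mul_of_pos_right hlt this]
    have h2 : v'' t ≤ C * (S / K * Real.exp (K * t)) :=
      (h t ht hvtpos).trans (mul_le_mul_of_nonneg_left hvle hC)
    have h3 : C * (S / K * Real.exp (K * t)) = C / K * v' t := by rw [hvt]; ring
    have h4 : C / K < K := by
      rw [div_lt_iff₀ hKpos]; nlinarith
    nlinarith
  have hanti : AntitoneOn v (Icc a b) := by
    refine antitoneOn_of_deriv_nonpos (convex_Icc a b)
      (fun x hx => (hv x hx).continuousAt.continuousWithinAt)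
      (fun x hx => (hv x (interior_subset hx)).differentiableAt.differentiableWithinAt)
      fun x hx => ?_
    rw [(hv x (interior_subset hx)).deriv]
    exact (hle x (interior_subset hx)).trans
      (mul_nonpos_of_nonpos_of_nonneg hSle (Real.exp_pos _).le)
  exact (hanti (left_mem_Icc.2 hab) (right_mem_Icc.2 hab) hab).trans hva

/-- On the interior of an interval, iterated one-dimensional derivatives within the closed interval
are ordinary derivatives. -/
lemma derivWithin_derivWithin_Icc_eq_deriv_deriv {w : ℝ → ℝ} {a b z : ℝ} (hz : z ∈ Ioo a b) :
    derivWithin (derivWithin w (Icc a b)) (Icc a b) z = deriv (deriv w) z := by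
  rw [derivWithin_of_mem_nhds (Icc_mem_nhds hz.1 hz.2)]
  refine EventuallyEq.deriv_eq ?_
  filter_upwards [Ioo_mem_nhds hz.1 hz.2] with y hy
  exact derivWithin_of_mem_nhds (Icc_mem_nhds hy.1 hy.2)

/-- For exponents at least one, `M - y` is controlled by `M ^ m - y ^ m` on `[0, M]`. -/
lemma rpow_sub_one_mul_sub_le {m M y : ℝ} (hm : 1 ≤ m) (hM : 0 < M) (hy : 0 ≤ y) (hyM : y ≤ M) :
    M ^ (m - 1) * (M - y) ≤ M ^ m - y ^ m := by
  have hpow : ∀ s : ℝ, 0 < s → s ^ m = s ^ (m - 1) * s := fun s hs => by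
    rw [← Real.rpow_add_one hs.ne', sub_add_cancel]
  rcases hy.eq_or_lt with rfl | hy'
  · rw [hpow M hM, Real.zero_rpow (by linarith)]; linarith
  · have := Real.rpow_le_rpow hy hyM (sub_nonneg.2 hm)
    rw [hpow M hM, hpow y hy']
    nlinarith

/-- A subsolution profile stays strictly below the minimum of `κ`. -/
lemma profile_lt_kappaMin {m : ℝ} (hm : 1 < m) {f : ℝ → ℝ → ℝ} {κ : ℝ → ℝ} {θ : ℝ}
    (hF1 : CondF1 f κ θ) {c₀ l₀ : ℝ} {φ₀ : ℝ → ℝ} (hF2 : CondF2 m f κ c₀ l₀ φ₀) :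
    ∀ z ∈ Icc (-l₀) l₀, φ₀ z < kappaMin κ := by
  obtain ⟨hf, hκ, -, -, -, hθ, hfpos, hκθ⟩ := hF1
  obtain ⟨hc, hl, hφ, hφl, hφr, hφpos, -, hsub⟩ := hF2
  obtain ⟨X, -, hX⟩ := isCompact_Icc.exists_sInf_image_eq (nonempty_Icc.2 zero_le_one)
    (hκ.continuous.continuousOn (s := Icc (0 : ℝ) 1))
  change kappaMin κ = κ X at hX
  obtain ⟨a, ha, hmax⟩ := isCompact_Icc.exists_isMaxOn
    (nonempty_Icc.2 (by linarith : -l₀ ≤ l₀)) hφ.continuousOn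
  set M : ℝ := φ₀ a with hMdef
  have hle : ∀ z ∈ Icc (-l₀) l₀, φ₀ z ≤ M := fun z hz => hmax hz
  have hM0 : 0 < M := (hφpos 0 ⟨by linarith, hl⟩).trans_le (hle 0 ⟨by linarith, hl.le⟩)
  have hnonneg : ∀ z ∈ Ioo (-l₀) l₀, 0 ≤ φ₀ z := fun z hz => (hφpos z hz).le
  have haI : a ∈ Ioo (-l₀) l₀ := by
    refine ⟨lt_of_le_of_ne ha.1 ?_, lt_of_le_of_ne ha.2 ?_⟩
    · intro h; rw [hMdef, ← h, hφl] at hM0; exact hM0.false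
    · intro h; rw [hMdef, h, hφr] at hM0; exact hM0.false
  intro z hz
  refine (hle z hz).trans_lt ?_
  rw [hX]
  by_contra! hκM
  have hfc : Continuous (f X) := by
    have := hf.continuous.comp (Continuous.prodMk_right X)
    exact this
  obtain ⟨F, hF⟩ := (isCompact_Icc (a := (0 : ℝ)) (b := M)).bddAbove_image hfc.continuousOn
  have hreact : ∀ y ∈ Icc 0 M, f X y * (κ X - y) ≤ max F 0 / M ^ (m - 1) * (M ^ m - y ^ m) := by
    intro y hy
    have hMp : 0 < M ^ (m - 1) := Real.rpow_pos_of_pos hM0 _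
    have h1 : max F 0 * (M - y) ≤ max F 0 / M ^ (m - 1) * (M ^ m - y ^ m) := by
      rw [div_mul_eq_mul_div, le_div_iff₀ hMp, mul_assoc, mul_comm (M - y)]
      exact mul_le_mul_of_nonneg_left (rpow_sub_one_mul_sub_le hm.le hM0 hy.1 hy.2)
        (le_max_right _ _)
    refine le_trans ?_ h1
    have hFy : f X y ≤ max F 0 := (hF ⟨y, hy, rfl⟩).trans (le_max_left _ _)
    have hF0 : 0 ≤ max F 0 := le_max_right _ _
    rcases le_total y (κ X) with hyκ | hyκ
    · exact (mul_le_mul_of_nonneg_right hFy (by linarith)).trans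
        (mul_le_mul_of_nonneg_left (by linarith) hF0)
    · have := hfpos X y ((hκθ X).trans_le hyκ)
      exact (mul_nonpos_of_nonneg_of_nonpos this.le (by linarith)).trans
        (mul_nonneg hF0 (by linarith [hy.2]))
  have hφI : ContDiffOn ℝ 2 φ₀ (Ioo (-l₀) l₀) := hφ.mono Ioo_subset_Icc_self
  have hw : ContDiffOn ℝ 2 (fun w => φ₀ w ^ m) (Ioo (-l₀) l₀) :=
    hφI.rpow_const_of_ne fun x hx => (hφpos x hx).ne'
  have hφd : ∀ x ∈ Ioo (-l₀) l₀, HasDerivAt φ₀ (deriv φ₀ x) x := fun x hx =>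
    ((hφI.differentiableOn (by norm_num)).differentiableAt
      (isOpen_Ioo.mem_nhds hx)).hasDerivAt
  have hwd : ∀ x ∈ Ioo (-l₀) l₀,
      HasDerivAt (fun w => φ₀ w ^ m) (deriv (fun w => φ₀ w ^ m) x) x := fun x hx =>
    ((hw.differentiableOn (by norm_num)).differentiableAt
      (isOpen_Ioo.mem_nhds hx)).hasDerivAt
  have hwdd : ∀ x ∈ Ioo (-l₀) l₀, HasDerivAt (deriv (fun w => φ₀ w ^ m))
      (deriv (deriv (fun w => φ₀ w ^ m)) x) x := fun x hx =>
    (((hw.deriv_of_isOpen isOpen_Ioo (m := 1) (by norm_num)).differentiableOn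
      (by norm_num)).differentiableAt (isOpen_Ioo.mem_nhds hx)).hasDerivAt
  have hwform : ∀ x ∈ Ioo (-l₀) l₀,
      deriv (fun w => φ₀ w ^ m) x = deriv φ₀ x * m * φ₀ x ^ (m - 1) := fun x hx =>
    ((hφd x hx).rpow_const (Or.inl (hφpos x hx).ne')).deriv
  have hda : deriv φ₀ a = 0 :=
    (hmax.isLocalMax (Icc_mem_nhds haI.1 haI.2)).deriv_eq_zero
  have hconst : ∀ b ∈ Ioo a l₀, φ₀ b = M := by
    intro b hb
    have hsubset : ∀ x ∈ Icc a b, x ∈ Ioo (-l₀) l₀ := fun x hx =>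
      ⟨haI.1.trans_le hx.1, hx.2.trans_lt hb.2⟩
    have hbI := hsubset b (right_mem_Icc.2 hb.1.le)
    have hv : M ^ m - φ₀ b ^ m ≤ 0 := by
      refine nonpos_of_second_deriv_le_of_deriv_pos (v := fun x => M ^ m - φ₀ x ^ m)
        (v' := fun x => -deriv (fun w => φ₀ w ^ m) x)
        (v'' := fun x => -deriv (deriv (fun w => φ₀ w ^ m)) x)
        (C := max F 0 / M ^ (m - 1)) hb.1.le (by positivity)
        (fun x hx => (hwd x (hsubset x hx)).const_sub _)
        (fun x hx => (hwdd x (hsubset x hx)).neg) (by simp [hMdef])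
        (by simp [hwform a haI, hda]) ?_
      intro x hx hpos
      have hxI := hsubset x hx
      have hφ' : deriv φ₀ x < 0 := by
        by_contra! hge
        have := hφpos x hxI
        have h1 : 0 ≤ deriv φ₀ x * m * φ₀ x ^ (m - 1) := by positivity
        rw [hwform x hxI] at hpos
        linarith
      have h1 := hsub X x (Ioo_subset_Icc_self hxI)
      rw [derivWithin_derivWithin_Icc_eq_deriv_deriv hxI,
        derivWithin_of_mem_nhds (Icc_mem_nhds hxI.1 hxI.2)] at h1
      have h2 := hreact (φ₀ x) ⟨hnonneg x hxI, hle x (Ioo_subset_Icc_self hxI)⟩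
      have h3 := mul_neg_of_pos_of_neg hc hφ'
      linarith
    refine le_antisymm (hle b (Ioo_subset_Icc_self hbI)) ?_
    by_contra! hlt
    have := Real.rpow_lt_rpow (hnonneg b hbI) hlt (by linarith : 0 < m)
    linarith
  have hlim : Tendsto φ₀ (nhdsWithin l₀ (Ioo a l₀)) (nhds (φ₀ l₀)) :=
    (hφ.continuousOn l₀ ⟨by linarith, le_rfl⟩).mono
      (fun x hx => ⟨(haI.1.trans hx.1).le, hx.2.le⟩)
  have : (nhdsWithin l₀ (Ioo a l₀)).NeBot := right_nhdsWithin_Ioo_neBot haI.2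
  have hlim' : Tendsto φ₀ (nhdsWithin l₀ (Ioo a l₀)) (nhds M) :=
    tendsto_const_nhds.congr' (by
      filter_upwards [self_mem_nhdsWithin] with x hx using (hconst x hx).symm)
  rw [hφr] at hlim
  exact hM0.ne (tendsto_nhds_unique hlim hlim')

/-- Under (F1) and (F2), the maximal 1-periodic stationary solution `p₂`
in the range `[κ₀, κ⁰]` lies strictly above every translate of the subsolution profile `φ₀`. -/
theorem maximal_stationary_above_subsolution_profile
    (m : ℝ) (hm : 1 < m) (f : ℝ → ℝ → ℝ) (κ : ℝ → ℝ) (θ : ℝ)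
    (hF1 : CondF1 f κ θ)
    (c₀ l₀ : ℝ) (φ₀ : ℝ → ℝ) (hF2 : CondF2 m f κ c₀ l₀ φ₀)
    (p₂ : ℝ → ℝ) (hpC2 : ContDiff ℝ 2 p₂) (hpper : ∀ x, p₂ (x + 1) = p₂ x)
    (hprange : ∀ x, kappaMin κ ≤ p₂ x ∧ p₂ x ≤ kappaMax κ)
    (hpstat : ∀ x, deriv (deriv (fun y => p₂ y ^ m)) x + f x (p₂ x) * (κ x - p₂ x) = 0)
    (hpmax : ∀ pt : ℝ → ℝ, ContDiff ℝ 2 pt →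
      (∀ x, kappaMin κ ≤ pt x ∧ pt x ≤ kappaMax κ) →
      (∀ x, deriv (deriv (fun y => pt y ^ m)) x + f x (pt x) * (κ x - pt x) = 0) →
      ∀ x, pt x ≤ p₂ x) :
    ∀ x₀ : ℝ, ∀ x ∈ Icc (x₀ - l₀) (x₀ + l₀), φ₀ (x - x₀) < p₂ x := by
  intro x₀ x hx
  exact (profile_lt_kappaMin hm hF1 hF2 (x - x₀)
    ⟨by linarith [hx.1], by linarith [hx.2]⟩).trans_le (hprange x).1
end
end
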